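/- Let m ≥ 2. Then for i = 0, 1 and every θ ∈ T_m one has 0 ≤ (A_i u_m^q)(θ) ≤ u_m^{q+1}(θ) for every q with 0 ≤ q ≤ m−2, and 0 ≤ (A_i u_m)(θ) ≤ u_m(θ), where u_m = u_m^{m−1}. Consequently, for every φ ∈ C(T_m, ℝ), every integer k ≥ m−1, and every θ ∈ T_m, |(A^k φ)(θ)| ≤ 2^k·u_m(θ)·‖φ‖_∞, where ‖φ‖_∞ is the supremum norm on T_m. -/

import Mathlib

open MeasureTheory

noncomputable section

/-- The fundamental simplex `T_m` of ordered tuples in `[-1,0]^m`. -/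
def TsetR (m : ℕ) : Set (Fin m → ℝ) :=
  {θ | (∀ i, θ i ∈ Set.Icc (-1 : ℝ) 0) ∧ Monotone θ}

/-- `(A₀ φ)(θ) = ∫_{θ₁}^{θ₂} ⋯ ∫_{θ_{m-1}}^{θ_m} φ(t₁,…,t_{m-1},0) dt_{m-1} ⋯ dt₁`,
written as an integral over the box `∏_j [θ_j, θ_{j+1}]`. -/
def A0op (m : ℕ) (φ : (Fin m → ℝ) → ℝ) (θ : Fin m → ℝ) : ℝ :=
  ∫ t : Fin (m - 1) → ℝ in
    Set.univ.pi (fun j : Fin (m - 1) => Set.Icc (θ ⟨(j : ℕ), by have := j.isLt; omega⟩)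
      (θ ⟨(j : ℕ) + 1, by have := j.isLt; omega⟩)),
    φ (fun i => if h : (i : ℕ) < m - 1 then t ⟨(i : ℕ), h⟩ else 0)

/-- `(A₁ φ)(θ) = ∫_{-1}^{θ₁} ∫_{θ₁}^{θ₂} ⋯ ∫_{θ_{m-1}}^{θ_m} φ(t₀,…,t_{m-1}) dt_{m-1} ⋯ dt₀`,
written as an integral over the box `[-1,θ₁] × ∏_j [θ_j, θ_{j+1}]`. -/
def A1op (m : ℕ) (φ : (Fin m → ℝ) → ℝ) (θ : Fin m → ℝ) : ℝ :=
  ∫ t : Fin m → ℝ in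
    Set.univ.pi (fun j : Fin m => Set.Icc
      (if h : (j : ℕ) = 0 then (-1 : ℝ) else θ ⟨(j : ℕ) - 1, by have := j.isLt; omega⟩)
      (θ j)),
    φ t

/-- The operator `A = A₀ + A₁`. -/
def Aop (m : ℕ) (φ : (Fin m → ℝ) → ℝ) : (Fin m → ℝ) → ℝ :=
  fun θ => A0op m φ θ + A1op m φ θ

/-- The polynomial `u_m^q` (with `0`-indexed coordinates):
`u_m^q(θ) = (∏_{i<j, j-i ≤ q} (θ_j - θ_i)) (∏_{i<j ≤ m-1, j-i ≥ m-q} (1 + θ_i - θ_j))`. -/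
def umq (m q : ℕ) (θ : Fin m → ℝ) : ℝ :=
  (∏ p ∈ Finset.univ.filter
      (fun p : Fin m × Fin m => p.1 < p.2 ∧ (p.2 : ℕ) - (p.1 : ℕ) ≤ q),
    (θ p.2 - θ p.1)) *
  (∏ p ∈ Finset.univ.filter
      (fun p : Fin m × Fin m => p.1 < p.2 ∧ (p.2 : ℕ) + 2 ≤ m ∧ m - q ≤ (p.2 : ℕ) - (p.1 : ℕ)),
    (1 + θ p.1 - θ p.2))

/-- If the factors of `∏ i ∈ S, f i` lie in `[0,1]` and those of `∏ k ∈ T, g k` dominate a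
subfamily of them, then `∏ i ∈ S, f i ≤ ∏ k ∈ T, g k`. -/
theorem prod_le_prod_of_injOn {ι κ : Type*} {S : Finset ι} {T : Finset κ} {f : ι → ℝ}
    {g : κ → ℝ} (e : κ → ι) (he : ∀ k ∈ T, e k ∈ S) (hinj : Set.InjOn e T)
    (hf : ∀ i ∈ S, f i ∈ Set.Icc (0 : ℝ) 1) (hfg : ∀ k ∈ T, f (e k) ≤ g k) :
    ∏ i ∈ S, f i ≤ ∏ k ∈ T, g k := by
  classical
  have hsub : T.image e ⊆ S := Finset.image_subset_iff.2 he
  have h1 : ∏ i ∈ S, f i ≤ ∏ i ∈ T.image e, f i := by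
    rw [← Finset.prod_sdiff hsub]
    refine mul_le_of_le_one_left (Finset.prod_nonneg fun i hi => (hf i (hsub hi)).1) ?_
    exact Finset.prod_le_one (fun i hi => (hf i (Finset.mem_sdiff.1 hi).1).1)
      (fun i hi => (hf i (Finset.mem_sdiff.1 hi).1).2)
  rw [Finset.prod_image hinj] at h1
  exact h1.trans (Finset.prod_le_prod (fun k hk => (hf _ (he k hk)).1) hfg)

/-- The pairs indexing the factors `x j - x i` of `umq m q`. -/
def diffPairs (m q : ℕ) : Finset (ℕ × ℕ) :=
  (Finset.range m ×ˢ Finset.range m).filter fun p => p.1 < p.2 ∧ p.2 - p.1 ≤ q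

/-- The pairs indexing the factors `1 + x i - x j` of `umq m q`. -/
def wrapPairs (m q : ℕ) : Finset (ℕ × ℕ) :=
  (Finset.range m ×ˢ Finset.range m).filter
    fun p => p.1 < p.2 ∧ p.2 + 2 ≤ m ∧ m - q ≤ p.2 - p.1

theorem mem_diffPairs {m q : ℕ} {p : ℕ × ℕ} :
    p ∈ diffPairs m q ↔ p.1 < p.2 ∧ p.2 < m ∧ p.2 - p.1 ≤ q := by
  simp only [diffPairs, Finset.mem_filter, Finset.mem_product, Finset.mem_range]
  omega

theorem mem_wrapPairs {m q : ℕ} {p : ℕ × ℕ} :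
    p ∈ wrapPairs m q ↔ p.1 < p.2 ∧ p.2 + 2 ≤ m ∧ m - q ≤ p.2 - p.1 := by
  simp only [wrapPairs, Finset.mem_filter, Finset.mem_product, Finset.mem_range]
  omega

/-- The polynomial `umq m q` evaluated at the first `m` terms of a sequence. -/
def umqSeq (m q : ℕ) (x : ℕ → ℝ) : ℝ :=
  (∏ p ∈ diffPairs m q, (x p.2 - x p.1)) * ∏ p ∈ wrapPairs m q, (1 + x p.1 - x p.2)

/-- Extension of a tuple by zero. -/
def extendZero {m : ℕ} (θ : Fin m → ℝ) (i : ℕ) : ℝ := if h : i < m then θ ⟨i, h⟩ else 0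

theorem extendZero_of_lt {m : ℕ} (θ : Fin m → ℝ) {i : ℕ} (h : i < m) :
    extendZero θ i = θ ⟨i, h⟩ := dif_pos h

theorem extendZero_val {m : ℕ} (θ : Fin m → ℝ) (i : Fin m) : extendZero θ i = θ i :=
  dif_pos i.isLt

theorem umq_eq_umqSeq (m q : ℕ) (θ : Fin m → ℝ) : umq m q θ = umqSeq m q (extendZero θ) := by
  unfold umq umqSeq
  congr 1
  · refine Finset.prod_bij (fun p _ => ((p.1 : ℕ), (p.2 : ℕ))) ?_ ?_ ?_ ?_
    · rintro ⟨i, j⟩ h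
      simp only [Finset.mem_filter, Fin.lt_def] at h
      exact mem_diffPairs.2 ⟨h.2.1, j.isLt, h.2.2⟩
    · rintro ⟨i, j⟩ - ⟨k, l⟩ - h
      simpa [Prod.ext_iff, Fin.ext_iff] using h
    · rintro ⟨i, j⟩ h
      obtain ⟨h1, h2, h3⟩ := mem_diffPairs.1 h
      exact ⟨(⟨i, h1.trans h2⟩, ⟨j, h2⟩),
        Finset.mem_filter.2 ⟨Finset.mem_univ _, h1, h3⟩, rfl⟩
    · intro p _
      simp only [extendZero_val]
  · refine Finset.prod_bij (fun p _ => ((p.1 : ℕ), (p.2 : ℕ))) ?_ ?_ ?_ ?_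
    · rintro ⟨i, j⟩ h
      simp only [Finset.mem_filter, Fin.lt_def] at h
      exact mem_wrapPairs.2 h.2
    · rintro ⟨i, j⟩ - ⟨k, l⟩ - h
      simpa [Prod.ext_iff, Fin.ext_iff] using h
    · rintro ⟨i, j⟩ h
      have h' := mem_wrapPairs.1 h
      simp only at h'
      exact ⟨(⟨i, by omega⟩, ⟨j, by omega⟩),
        Finset.mem_filter.2 ⟨Finset.mem_univ _, h'⟩, rfl⟩
    · intro p _
      simp only [extendZero_val]

theorem monotone_extendZero {m : ℕ} {θ : Fin m → ℝ} (hθ : θ ∈ TsetR m) :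
    Monotone (extendZero θ) := by
  intro i j hij
  by_cases hj : j < m
  · rw [extendZero_of_lt θ hj, extendZero_of_lt θ (hij.trans_lt hj)]
    exact hθ.2 hij
  · by_cases hi : i < m
    · simpa [extendZero, hi, hj] using (hθ.1 ⟨i, hi⟩).2
    · simp [extendZero, hi, hj]

theorem extendZero_mem_Icc {m : ℕ} {θ : Fin m → ℝ} (hθ : θ ∈ TsetR m) (i : ℕ) :
    extendZero θ i ∈ Set.Icc (-1 : ℝ) 0 := by
  unfold extendZero
  split_ifs
  · exact hθ.1 _
  · simp

theorem diff_mem_Icc {x : ℕ → ℝ} (hx : Monotone x) (hx' : ∀ i, x i ∈ Set.Icc (-1 : ℝ) 0)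
    {i j : ℕ} (h : i ≤ j) : x j - x i ∈ Set.Icc (0 : ℝ) 1 := by
  have := hx h
  have := hx' i
  have := hx' j
  simp only [Set.mem_Icc] at *
  constructor <;> linarith

theorem wrap_mem_Icc {x : ℕ → ℝ} (hx : Monotone x) (hx' : ∀ i, x i ∈ Set.Icc (-1 : ℝ) 0)
    {i j : ℕ} (h : i ≤ j) : 1 + x i - x j ∈ Set.Icc (0 : ℝ) 1 := by
  have := diff_mem_Icc hx hx' h
  simp only [Set.mem_Icc] at *
  constructor <;> linarith

theorem umqSeq_nonneg {m q : ℕ} {x : ℕ → ℝ} (hx : Monotone x)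
    (hx' : ∀ i, x i ∈ Set.Icc (-1 : ℝ) 0) : 0 ≤ umqSeq m q x :=
  mul_nonneg
    (Finset.prod_nonneg fun _ hp => (diff_mem_Icc hx hx' (mem_diffPairs.1 hp).1.le).1)
    (Finset.prod_nonneg fun _ hp => (wrap_mem_Icc hx hx' (mem_wrapPairs.1 hp).1.le).1)

theorem umq_nonneg {m q : ℕ} {θ : Fin m → ℝ} (hθ : θ ∈ TsetR m) : 0 ≤ umq m q θ := by
  rw [umq_eq_umqSeq]
  exact umqSeq_nonneg (monotone_extendZero hθ) (extendZero_mem_Icc hθ)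

/-- Comparison of `umqSeq m q y * ∏ v` with `umqSeq m (q + 1) x` through an injective matching of
factors. -/
theorem umqSeq_mul_prod_le {m q : ℕ} {x y v : ℕ → ℝ} {V : Finset ℕ}
    (hy : Monotone y) (hy' : ∀ i, y i ∈ Set.Icc (-1 : ℝ) 0)
    (hv : ∀ i ∈ V, v i ∈ Set.Icc (0 : ℝ) 1)
    (e : (ℕ × ℕ) ⊕ (ℕ × ℕ) → ((ℕ × ℕ) ⊕ (ℕ × ℕ)) ⊕ ℕ)
    (he : ∀ k ∈ (diffPairs m (q + 1)).disjSum (wrapPairs m (q + 1)),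
      e k ∈ ((diffPairs m q).disjSum (wrapPairs m q)).disjSum V)
    (hinj : Set.InjOn e ((diffPairs m (q + 1)).disjSum (wrapPairs m (q + 1))))
    (hle : ∀ k ∈ (diffPairs m (q + 1)).disjSum (wrapPairs m (q + 1)),
      Sum.elim (Sum.elim (fun p => y p.2 - y p.1) (fun p => 1 + y p.1 - y p.2)) v (e k) ≤
        Sum.elim (fun p => x p.2 - x p.1) (fun p => 1 + x p.1 - x p.2) k) :
    umqSeq m q y * ∏ i ∈ V, v i ≤ umqSeq m (q + 1) x := by
  have key := prod_le_prod_of_injOn e he hinj (f := Sum.elim (Sum.elim (fun p => y p.2 - y p.1)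
    (fun p => 1 + y p.1 - y p.2)) v) ?_ hle
  · simpa only [umqSeq, Finset.prod_disjSum, Sum.elim_inl, Sum.elim_inr] using key
  · rintro ((p | p) | i) h
    · rw [Finset.inl_mem_disjSum, Finset.inl_mem_disjSum] at h
      exact diff_mem_Icc hy hy' (mem_diffPairs.1 h).1.le
    · rw [Finset.inl_mem_disjSum, Finset.inr_mem_disjSum] at h
      exact wrap_mem_Icc hy hy' (mem_wrapPairs.1 h).1.le
    · rw [Finset.inr_mem_disjSum] at h
      exact hv i h

theorem umqSeq_mul_volume_le_zero {m q : ℕ} {x y : ℕ → ℝ}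
    (hx : Monotone x) (hx' : ∀ i, x i ∈ Set.Icc (-1 : ℝ) 0)
    (hy : Monotone y) (hy' : ∀ i, y i ∈ Set.Icc (-1 : ℝ) 0)
    (hxy : ∀ i, i + 1 < m → y i ∈ Set.Icc (x i) (x (i + 1))) (hlast : y (m - 1) = 0) :
    umqSeq m q y * ∏ i ∈ Finset.range (m - 1), (x (i + 1) - x i) ≤ umqSeq m (q + 1) x := by
  refine umqSeq_mul_prod_le (v := fun i => x (i + 1) - x i) hy hy'
    (fun i _ => diff_mem_Icc hx hx' (Nat.le_succ i))
    (Sum.elim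
      (fun p => if p.2 = p.1 + 1 then .inr p.1 else .inl (.inl (p.1, p.2 - 1)))
      (fun p => if p.1 = 0 then .inl (.inl (p.2, m - 1)) else .inl (.inr (p.1 - 1, p.2))))
    ?_ ?_ ?_
  · rintro (⟨i, j⟩ | ⟨i, j⟩) h <;>
      simp only [Finset.inl_mem_disjSum, Finset.inr_mem_disjSum, mem_diffPairs, mem_wrapPairs,
        Sum.elim_inl, Sum.elim_inr] at h ⊢ <;> split_ifs <;>
      simp only [Finset.inl_mem_disjSum, Finset.inr_mem_disjSum, mem_diffPairs, mem_wrapPairs,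
        Finset.mem_range] <;> omega
  · rintro (⟨i, j⟩ | ⟨i, j⟩) h (⟨k, l⟩ | ⟨k, l⟩) h' heq <;>
      simp only [Finset.mem_coe, Finset.inl_mem_disjSum, Finset.inr_mem_disjSum, mem_diffPairs,
        mem_wrapPairs, Sum.elim_inl, Sum.elim_inr] at h h' heq <;>
      split_ifs at heq <;>
      simp only [Sum.inl.injEq, Sum.inr.injEq, Prod.mk.injEq, reduceCtorEq] at heq ⊢ <;> omega
  · rintro (⟨i, j⟩ | ⟨i, j⟩) h <;>
      simp only [Finset.inl_mem_disjSum, Finset.inr_mem_disjSum, mem_diffPairs, mem_wrapPairs,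
        Sum.elim_inl, Sum.elim_inr] at h ⊢ <;> split_ifs with hc <;>
      simp only [Sum.elim_inl, Sum.elim_inr]
    · rw [hc]
    · have h1 := (hxy (j - 1) (by omega)).2
      have h2 := (hxy i (by omega)).1
      rw [Nat.sub_add_cancel (by omega)] at h1
      linarith
    · have h1 := (hxy j (by omega)).1
      have h2 := (hx' i).1
      rw [hlast]
      linarith
    · have h1 := (hxy (i - 1) (by omega)).2
      have h2 := (hxy j (by omega)).1
      rw [Nat.sub_add_cancel (by omega)] at h1
      linarith

/-- The lower endpoint of the `k`-th side of the box in `A1op`. -/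
def lowerEnd (x : ℕ → ℝ) (k : ℕ) : ℝ := if k = 0 then -1 else x (k - 1)

theorem lowerEnd_le {x : ℕ → ℝ} (hx : Monotone x) (hx' : ∀ i, x i ∈ Set.Icc (-1 : ℝ) 0)
    (k : ℕ) : lowerEnd x k ≤ x k := by
  unfold lowerEnd
  split_ifs
  · exact (hx' k).1
  · exact hx (Nat.sub_le k 1)

theorem neg_one_le_lowerEnd {x : ℕ → ℝ} (hx' : ∀ i, x i ∈ Set.Icc (-1 : ℝ) 0)
    (k : ℕ) : -1 ≤ lowerEnd x k := by
  unfold lowerEnd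
  split_ifs
  · exact le_rfl
  · exact (hx' _).1

theorem umqSeq_mul_volume_le_one {m q : ℕ} {x y : ℕ → ℝ}
    (hx : Monotone x) (hx' : ∀ i, x i ∈ Set.Icc (-1 : ℝ) 0)
    (hy : Monotone y) (hy' : ∀ i, y i ∈ Set.Icc (-1 : ℝ) 0)
    (hxy : ∀ i, i < m → y i ∈ Set.Icc (lowerEnd x i) (x i)) :
    umqSeq m q y * ∏ i ∈ Finset.range m, (x i - lowerEnd x i) ≤ umqSeq m (q + 1) x := by
  refine umqSeq_mul_prod_le (v := fun i => x i - lowerEnd x i) hy hy' ?_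
    (Sum.elim
      (fun p => if p.2 = p.1 + 1 then .inr p.2 else .inl (.inl (p.1 + 1, p.2)))
      (fun p => if p.2 + 2 = m then if p.1 = 0 then .inr 0 else .inl (.inl (0, p.1))
        else .inl (.inr (p.1, p.2 + 1))))
    ?_ ?_ ?_
  · intro i _
    have h1 := lowerEnd_le hx hx' i
    have h2 := neg_one_le_lowerEnd hx' i
    have h3 := (hx' i).2
    constructor <;> linarith
  · rintro (⟨i, j⟩ | ⟨i, j⟩) h <;>
      simp only [Finset.inl_mem_disjSum, Finset.inr_mem_disjSum, mem_diffPairs, mem_wrapPairs,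
        Sum.elim_inl, Sum.elim_inr] at h ⊢ <;> split_ifs <;>
      simp only [Finset.inl_mem_disjSum, Finset.inr_mem_disjSum, mem_diffPairs, mem_wrapPairs,
        Finset.mem_range] <;> omega
  · rintro (⟨i, j⟩ | ⟨i, j⟩) h (⟨k, l⟩ | ⟨k, l⟩) h' heq <;>
      simp only [Finset.mem_coe, Finset.inl_mem_disjSum, Finset.inr_mem_disjSum, mem_diffPairs,
        mem_wrapPairs, Sum.elim_inl, Sum.elim_inr] at h h' heq <;>
      split_ifs at heq <;>
      simp only [Sum.inl.injEq, Sum.inr.injEq, Prod.mk.injEq, reduceCtorEq, false_and] at heq ⊢ <;> omega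
  · have hsucc : ∀ i, lowerEnd x (i + 1) = x i := fun i => by simp [lowerEnd]
    have hzero : lowerEnd x 0 = -1 := by simp [lowerEnd]
    rintro (⟨i, j⟩ | ⟨i, j⟩) h <;>
      simp only [Finset.inl_mem_disjSum, Finset.inr_mem_disjSum, mem_diffPairs, mem_wrapPairs,
        Sum.elim_inl, Sum.elim_inr] at h ⊢ <;> split_ifs with hc <;>
      simp only [Sum.elim_inl, Sum.elim_inr]
    · rw [hc, hsucc]
    · have h1 := (hxy j (by omega)).2
      have h2 := (hxy (i + 1) (by omega)).1
      rw [hsucc] at h2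
      linarith
    · have h1 := (hx' j).2
      rw [show i = 0 by assumption, hzero]
      linarith
    · have h1 := (hxy i (by omega)).2
      have h2 := (hxy 0 (by omega)).1
      have h3 := (hx' j).2
      rw [hzero] at h2
      linarith
    · have h1 := (hxy i (by omega)).2
      have h2 := (hxy (j + 1) (by omega)).1
      rw [hsucc] at h2
      linarith

theorem abs_setIntegral_box_le {n : ℕ} {a b : Fin n → ℝ} (hab : a ≤ b) {f : (Fin n → ℝ) → ℝ}
    {U : ℝ} (hU : 0 ≤ U)
    (hf : ∀ t ∈ Set.univ.pi (fun j => Set.Icc (a j) (b j)), |f t| * ∏ j, (b j - a j) ≤ U) :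
    |∫ t in Set.univ.pi (fun j => Set.Icc (a j) (b j)), f t| ≤ U := by
  rw [Set.pi_univ_Icc] at hf ⊢
  have hvol : volume.real (Set.Icc a b) = ∏ j, (b j - a j) := Real.volume_Icc_pi_toReal hab
  have hfin : volume (Set.Icc a b) < ⊤ := isCompact_Icc.measure_lt_top
  have hnn : 0 ≤ ∏ j, (b j - a j) := Finset.prod_nonneg fun j _ => sub_nonneg.2 (hab j)
  rcases hnn.eq_or_lt with h0 | hpos
  · have hz : volume (Set.Icc a b) = 0 := by
      rw [← h0, measureReal_eq_zero_iff hfin.ne] at hvol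
      exact hvol
    rw [setIntegral_measure_zero _ hz, abs_zero]
    exact hU
  · have := norm_setIntegral_le_of_norm_le_const (f := f) (C := U / ∏ j, (b j - a j)) hfin
      fun t ht => (le_div_iff₀ hpos).2 (hf t ht)
    rwa [hvol, div_mul_cancel₀ _ hpos.ne'] at this

/-- The point `(t₁,…,t_{m-1},0)` at which `A0op` evaluates its argument. -/
def appendZero (m : ℕ) (t : Fin (m - 1) → ℝ) : Fin m → ℝ :=
  fun i => if h : (i : ℕ) < m - 1 then t ⟨(i : ℕ), h⟩ else 0

/-- The domain of integration of `A0op`. -/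
def boxZero (m : ℕ) (θ : Fin m → ℝ) : Set (Fin (m - 1) → ℝ) :=
  Set.univ.pi (fun j : Fin (m - 1) => Set.Icc (θ ⟨(j : ℕ), by have := j.isLt; omega⟩)
      (θ ⟨(j : ℕ) + 1, by have := j.isLt; omega⟩))

/-- The domain of integration of `A1op`. -/
def boxOne (m : ℕ) (θ : Fin m → ℝ) : Set (Fin m → ℝ) :=
  Set.univ.pi (fun j : Fin m => Set.Icc
      (if h : (j : ℕ) = 0 then (-1 : ℝ) else θ ⟨(j : ℕ) - 1, by have := j.isLt; omega⟩)
      (θ j))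

theorem appendZero_mem_TsetR {m : ℕ} {θ : Fin m → ℝ} (hθ : θ ∈ TsetR m)
    {t : Fin (m - 1) → ℝ} (ht : t ∈ boxZero m θ) : appendZero m t ∈ TsetR m := by
  have hlo : ∀ j : Fin (m - 1), θ ⟨j, by have := j.isLt; omega⟩ ≤ t j :=
    fun j => (ht j (Set.mem_univ j)).1
  have hhi : ∀ j : Fin (m - 1), t j ≤ θ ⟨j + 1, by have := j.isLt; omega⟩ :=
    fun j => (ht j (Set.mem_univ j)).2
  have hnonpos : ∀ i, appendZero m t i ≤ 0 := fun i => by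
    unfold appendZero
    split_ifs with h
    · exact (hhi _).trans (hθ.1 _).2
    · exact le_rfl
  refine ⟨fun i => ⟨?_, hnonpos i⟩, fun i j hij => ?_⟩
  · unfold appendZero
    split_ifs with h
    · exact (hθ.1 _).1.trans (hlo _)
    · norm_num
  · rcases hij.eq_or_lt with rfl | hlt
    · exact le_rfl
    by_cases hj : (j : ℕ) < m - 1
    · have hi : (i : ℕ) < m - 1 := lt_trans hlt hj
      simp only [appendZero, hi, hj, dif_pos]
      exact (hhi ⟨i, hi⟩).trans ((hθ.2 (Fin.mk_le_mk.2 hlt)).trans (hlo ⟨j, hj⟩))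
    · have : appendZero m t j = 0 := dif_neg hj
      rw [this]
      exact hnonpos i

theorem boxOne_bounds {m : ℕ} {θ t : Fin m → ℝ} (ht : t ∈ boxOne m θ) (i : ℕ) (hi : i < m) :
    extendZero t i ∈ Set.Icc (lowerEnd (extendZero θ) i) (extendZero θ i) := by
  have h := ht ⟨i, hi⟩ (Set.mem_univ _)
  rw [extendZero_of_lt t hi, extendZero_of_lt θ hi]
  refine ⟨le_trans (le_of_eq ?_) h.1, h.2⟩
  unfold lowerEnd
  split_ifs
  · rfl
  · rw [extendZero_of_lt θ (show i - 1 < m by omega)]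

theorem boxOne_subset_TsetR {m : ℕ} {θ : Fin m → ℝ} (hθ : θ ∈ TsetR m) :
    boxOne m θ ⊆ TsetR m := by
  intro t ht
  have hb := fun i : Fin m => boxOne_bounds ht i i.isLt
  simp only [extendZero_val] at hb
  refine ⟨fun i => ⟨(neg_one_le_lowerEnd (extendZero_mem_Icc hθ) i).trans (hb i).1,
    (hb i).2.trans (hθ.1 i).2⟩, fun i j hij => ?_⟩
  rcases hij.eq_or_lt with rfl | hlt
  · exact le_rfl
  refine (hb i).2.trans (le_trans ?_ (hb j).1)
  have hlt' : (i : ℕ) < j := hlt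
  rw [lowerEnd, if_neg (by omega), ← extendZero_val θ i]
  exact monotone_extendZero hθ (by omega)

theorem abs_A0op_le {m q : ℕ} (hm : 2 ≤ m) {f : (Fin m → ℝ) → ℝ} {c : ℝ} (hc : 0 ≤ c)
    (hf : ∀ θ ∈ TsetR m, |f θ| ≤ c * umq m q θ) {θ : Fin m → ℝ} (hθ : θ ∈ TsetR m) :
    |A0op m f θ| ≤ c * umq m (q + 1) θ := by
  refine abs_setIntegral_box_le (fun j => hθ.2 (Fin.mk_le_mk.2 (Nat.le_succ j)))
    (mul_nonneg hc (umq_nonneg hθ)) fun t ht => ?_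
  have hT := appendZero_mem_TsetR hθ ht
  have hvol : ∏ j : Fin (m - 1), (θ ⟨(j : ℕ) + 1, by have := j.isLt; omega⟩ -
      θ ⟨(j : ℕ), by have := j.isLt; omega⟩) =
      ∏ i ∈ Finset.range (m - 1), (extendZero θ (i + 1) - extendZero θ i) := by
    rw [Finset.prod_range]
    refine Finset.prod_congr rfl fun j _ => ?_
    rw [extendZero_of_lt, extendZero_of_lt]
  have hle := umqSeq_mul_volume_le_zero (m := m) (q := q) (monotone_extendZero hθ)
    (extendZero_mem_Icc hθ) (monotone_extendZero hT) (extendZero_mem_Icc hT) (fun i hi => ?_) ?_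
  · rw [← umq_eq_umqSeq, ← umq_eq_umqSeq, ← hvol] at hle
    refine le_trans (mul_le_mul_of_nonneg_right (hf _ hT) (Finset.prod_nonneg fun j _ =>
      sub_nonneg.2 (hθ.2 (Fin.mk_le_mk.2 (Nat.le_succ j))))) ?_
    rw [mul_assoc]
    exact mul_le_mul_of_nonneg_left hle hc
  · have hi' : i < m - 1 := by omega
    have h := ht ⟨i, hi'⟩ (Set.mem_univ _)
    rw [extendZero_of_lt _ hi, extendZero_of_lt _ (show i < m by omega),
      extendZero_of_lt _ (show i < m by omega)]
    simpa [appendZero, hi'] using h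
  · rw [extendZero_of_lt _ (show m - 1 < m by omega)]
    simp [appendZero]

theorem abs_A1op_le {m q : ℕ} {f : (Fin m → ℝ) → ℝ} {c : ℝ} (hc : 0 ≤ c)
    (hf : ∀ θ ∈ TsetR m, |f θ| ≤ c * umq m q θ) {θ : Fin m → ℝ} (hθ : θ ∈ TsetR m) :
    |A1op m f θ| ≤ c * umq m (q + 1) θ := by
  have hend : ∀ j : Fin m, (if h : (j : ℕ) = 0 then (-1 : ℝ)
      else θ ⟨(j : ℕ) - 1, by have := j.isLt; omega⟩) = lowerEnd (extendZero θ) j := fun j => by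
    unfold lowerEnd
    split_ifs with h
    · rfl
    · rw [extendZero_of_lt]
  have hside : ∀ j : Fin m, lowerEnd (extendZero θ) j ≤ θ j := fun j => by
    simpa only [extendZero_val] using
      lowerEnd_le (monotone_extendZero hθ) (extendZero_mem_Icc hθ) j
  refine abs_setIntegral_box_le (fun j => (hend j).trans_le (hside j))
    (mul_nonneg hc (umq_nonneg hθ)) fun t ht => ?_
  have hT := boxOne_subset_TsetR hθ ht
  have hle := umqSeq_mul_volume_le_one (m := m) (q := q) (monotone_extendZero hθ)
    (extendZero_mem_Icc hθ) (monotone_extendZero hT) (extendZero_mem_Icc hT) (boxOne_bounds ht)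
  rw [← umq_eq_umqSeq, ← umq_eq_umqSeq, Finset.prod_range] at hle
  simp only [extendZero_val] at hle
  simp only [hend]
  refine le_trans (mul_le_mul_of_nonneg_right (hf _ hT) (Finset.prod_nonneg fun j _ =>
    sub_nonneg.2 (hside j))) ?_
  rw [mul_assoc]
  exact mul_le_mul_of_nonneg_left hle hc

theorem A0op_nonneg {m : ℕ} {f : (Fin m → ℝ) → ℝ} (hf : ∀ θ ∈ TsetR m, 0 ≤ f θ)
    {θ : Fin m → ℝ} (hθ : θ ∈ TsetR m) : 0 ≤ A0op m f θ :=
  setIntegral_nonneg (MeasurableSet.univ_pi fun _ => measurableSet_Icc)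
    fun _ ht => hf _ (appendZero_mem_TsetR hθ ht)

theorem A1op_nonneg {m : ℕ} {f : (Fin m → ℝ) → ℝ} (hf : ∀ θ ∈ TsetR m, 0 ≤ f θ)
    {θ : Fin m → ℝ} (hθ : θ ∈ TsetR m) : 0 ≤ A1op m f θ :=
  setIntegral_nonneg (MeasurableSet.univ_pi fun _ => measurableSet_Icc)
    fun _ ht => hf _ (boxOne_subset_TsetR hθ ht)

theorem op_umq_bounds {m : ℕ} (hm : 2 ≤ m) (q : ℕ) {θ : Fin m → ℝ} (hθ : θ ∈ TsetR m) :
    (0 ≤ A0op m (umq m q) θ ∧ A0op m (umq m q) θ ≤ umq m (q + 1) θ) ∧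
      (0 ≤ A1op m (umq m q) θ ∧ A1op m (umq m q) θ ≤ umq m (q + 1) θ) := by
  have hself : ∀ ϑ ∈ TsetR m, |umq m q ϑ| ≤ 1 * umq m q ϑ := fun ϑ hϑ => by
    rw [one_mul, abs_of_nonneg (umq_nonneg hϑ)]
  have h0 := abs_A0op_le hm zero_le_one hself hθ
  have h1 := abs_A1op_le zero_le_one hself hθ
  rw [one_mul] at h0 h1
  exact ⟨⟨A0op_nonneg (fun _ => umq_nonneg) hθ, (le_abs_self _).trans h0⟩,
    ⟨A1op_nonneg (fun _ => umq_nonneg) hθ, (le_abs_self _).trans h1⟩⟩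

theorem umq_zero (m : ℕ) (θ : Fin m → ℝ) : umq m 0 θ = 1 := by
  have h1 : diffPairs m 0 = ∅ := Finset.eq_empty_of_forall_notMem fun p hp => by
    rw [mem_diffPairs] at hp
    omega
  have h2 : wrapPairs m 0 = ∅ := Finset.eq_empty_of_forall_notMem fun p hp => by
    rw [mem_wrapPairs] at hp
    omega
  simp [umq_eq_umqSeq, umqSeq, h1, h2]

theorem umq_of_le {m k : ℕ} (hk : m - 1 ≤ k) (θ : Fin m → ℝ) :
    umq m k θ = umq m (m - 1) θ := by
  have h1 : diffPairs m k = diffPairs m (m - 1) := Finset.ext fun p => by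
    simp only [mem_diffPairs]
    omega
  have h2 : wrapPairs m k = wrapPairs m (m - 1) := Finset.ext fun p => by
    simp only [mem_wrapPairs]
    omega
  simp only [umq_eq_umqSeq, umqSeq, h1, h2]

theorem isCompact_TsetR (m : ℕ) : IsCompact (TsetR m) := by
  have h : TsetR m = Set.univ.pi (fun _ : Fin m => Set.Icc (-1 : ℝ) 0) ∩ {θ | Monotone θ} := by
    ext θ
    simp only [TsetR, Set.mem_inter_iff, Set.mem_univ_pi, Set.mem_ofPred_eq]
  rw [h]
  exact (isCompact_univ_pi fun _ => isCompact_Icc).inter_right isClosed_monotone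

theorem abs_iterate_Aop_le {m : ℕ} (hm : 2 ≤ m) {φ : (Fin m → ℝ) → ℝ} {M : ℝ} (hM : 0 ≤ M)
    (hφ : ∀ θ ∈ TsetR m, |φ θ| ≤ M) (k : ℕ) :
    ∀ θ ∈ TsetR m, |(Aop m)^[k] φ θ| ≤ 2 ^ k * M * umq m k θ := by
  induction k with
  | zero => simpa [umq_zero] using hφ
  | succ k ih =>
    intro θ hθ
    have hc : (0 : ℝ) ≤ 2 ^ k * M := by positivity
    rw [Function.iterate_succ_apply']
    calc |Aop m ((Aop m)^[k] φ) θ|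
        ≤ |A0op m ((Aop m)^[k] φ) θ| + |A1op m ((Aop m)^[k] φ) θ| := abs_add_le _ _
      _ ≤ 2 ^ k * M * umq m (k + 1) θ + 2 ^ k * M * umq m (k + 1) θ :=
        add_le_add (abs_A0op_le hm hc ih hθ) (abs_A1op_le hc ih hθ)
      _ = 2 ^ (k + 1) * M * umq m (k + 1) θ := by ring

theorem statement15 (m : ℕ) (hm : 2 ≤ m) :
    (∀ q : ℕ, q ≤ m - 2 → ∀ θ ∈ TsetR m,
      (0 ≤ A0op m (umq m q) θ ∧ A0op m (umq m q) θ ≤ umq m (q + 1) θ) ∧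
      (0 ≤ A1op m (umq m q) θ ∧ A1op m (umq m q) θ ≤ umq m (q + 1) θ)) ∧
    (∀ θ ∈ TsetR m,
      (0 ≤ A0op m (umq m (m - 1)) θ ∧ A0op m (umq m (m - 1)) θ ≤ umq m (m - 1) θ) ∧
      (0 ≤ A1op m (umq m (m - 1)) θ ∧ A1op m (umq m (m - 1)) θ ≤ umq m (m - 1) θ)) ∧
    (∀ φ : (Fin m → ℝ) → ℝ, ContinuousOn φ (TsetR m) →
      ∀ k : ℕ, m - 1 ≤ k → ∀ θ ∈ TsetR m,
        |(Aop m)^[k] φ θ| ≤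
          2 ^ k * umq m (m - 1) θ * sSup ((fun ϑ => |φ ϑ|) '' TsetR m)) := by
  refine ⟨fun q _ θ hθ => op_umq_bounds hm q hθ, fun θ hθ => ?_, fun φ hφ k hk θ hθ => ?_⟩
  · have h := op_umq_bounds hm (m - 1) hθ
    rwa [umq_of_le (Nat.le_succ (m - 1))] at h
  · have hbdd : BddAbove ((fun ϑ => |φ ϑ|) '' TsetR m) :=
      (isCompact_TsetR m).bddAbove_image hφ.abs
    have hsup : ∀ ϑ ∈ TsetR m, |φ ϑ| ≤ sSup ((fun ϑ => |φ ϑ|) '' TsetR m) :=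
      fun ϑ hϑ => le_csSup hbdd (Set.mem_image_of_mem _ hϑ)
    have h := abs_iterate_Aop_le hm ((abs_nonneg _).trans (hsup θ hθ)) hsup k θ hθ
    rwa [umq_of_le hk, mul_right_comm] at h
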